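/- Let m ≥ 0 and s ≥ 2, and let u be a smooth function defined on a neighborhood of K_{[2,s]} := {(t,x) : 4 ≤ t² − r² ≤ s², r < t − 1} such that for each t the function u(t,·) is supported in {x : |x| < t − 1}. Then E_m(s, u)^{1/2} ≤ E_m(2, u)^{1/2} + ∫₂^s ‖(−□u + m²u)‖_{L²_f(H_{s'})} ds'. -/

import Mathlib

open MeasureTheory Real
noncomputable section

def pder (α : Fin 4) (φ : (Fin 4 → ℝ) → ℝ) (y : Fin 4 → ℝ) : ℝ :=
  fderiv ℝ φ y (Pi.single α 1)

def Lb (a : Fin 3) (φ : (Fin 4 → ℝ) → ℝ) (y : Fin 4 → ℝ) : ℝ :=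
  y a.succ * pder 0 φ y + y 0 * pder a.succ φ y

def rotVF (a b : Fin 3) (φ : (Fin 4 → ℝ) → ℝ) (y : Fin 4 → ℝ) : ℝ :=
  y a.succ * pder b.succ φ y - y b.succ * pder a.succ φ y

def Box (φ : (Fin 4 → ℝ) → ℝ) (y : Fin 4 → ℝ) : ℝ :=
  - pder 0 (pder 0 φ) y + ∑ a : Fin 3, pder a.succ (pder a.succ φ) y

inductive VF : Type
  | pd : Fin 4 → VF
  | boost : Fin 3 → VF
  | rot : Fin 3 → Fin 3 → VF
  deriving DecidableEq, Fintype

def VF.apply : VF → ((Fin 4 → ℝ) → ℝ) → ((Fin 4 → ℝ) → ℝ)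
  | .pd α, φ => pder α φ
  | .boost a, φ => Lb a φ
  | .rot a b, φ => rotVF a b φ

def applyComp {n : ℕ} (Γ : Fin n → VF) (φ : (Fin 4 → ℝ) → ℝ) : (Fin 4 → ℝ) → ℝ :=
  (List.ofFn Γ).foldr VF.apply φ

def spt (t : ℝ) (x : Fin 3 → ℝ) : Fin 4 → ℝ := Fin.cons t x
def rad (x : Fin 3 → ℝ) : ℝ := Real.sqrt (∑ i, x i ^ 2)
def L2normSq (g : (Fin 3 → ℝ) → ℝ) : ℝ := ∫ x : Fin 3 → ℝ, g x ^ 2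
def L2norm (g : (Fin 3 → ℝ) → ℝ) : ℝ := Real.sqrt (L2normSq g)

def pderx (a : Fin 3) (g : (Fin 3 → ℝ) → ℝ) (x : Fin 3 → ℝ) : ℝ :=
  fderiv ℝ g x (Pi.single a 1)
def pderxIter (k : Fin 3 → ℕ) (g : (Fin 3 → ℝ) → ℝ) : (Fin 3 → ℝ) → ℝ :=
  (pderx 0)^[k 0] ((pderx 1)^[k 1] ((pderx 2)^[k 2] g))
def sobNormSq (N : ℕ) (g : (Fin 3 → ℝ) → ℝ) : ℝ :=
  ∑ k ∈ Finset.univ.filter (fun k : Fin 3 → Fin (N+1) => ∑ i, (k i : ℕ) ≤ N),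
    L2normSq (pderxIter (fun i => (k i : ℕ)) g)
def sobNorm (N : ℕ) (g : (Fin 3 → ℝ) → ℝ) : ℝ := Real.sqrt (sobNormSq N g)

def hypPoint (s : ℝ) (x : Fin 3 → ℝ) : Fin 4 → ℝ := spt (Real.sqrt (s^2 + ∑ i, x i ^ 2)) x
def hypL2Sq (s : ℝ) (φ : (Fin 4 → ℝ) → ℝ) : ℝ := ∫ x : Fin 3 → ℝ, (φ (hypPoint s x))^2
def hypEnergy (μ s : ℝ) (φ : (Fin 4 → ℝ) → ℝ) : ℝ :=
  ∫ x : Fin 3 → ℝ,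
    ((pder 0 φ (hypPoint s x))^2 + ∑ a : Fin 3, (pder a.succ φ (hypPoint s x))^2
      + 2 * ∑ a : Fin 3, (x a / hypPoint s x 0) * pder 0 φ (hypPoint s x) * pder a.succ φ (hypPoint s x)
      + μ^2 * (φ (hypPoint s x))^2)

def flatEnergy (μ t : ℝ) (φ : (Fin 4 → ℝ) → ℝ) : ℝ :=
  (∑ α : Fin 4, L2normSq (fun x => pder α φ (spt t x))) + μ^2 * L2normSq (fun x => φ (spt t x))

def Xnorm (N : ℕ) (δ m : ℝ) (φ ψ : (Fin 4 → ℝ) → ℝ) : ℝ :=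
  (⨆ t : {t : ℝ // 2 ≤ t}, ∑ n ∈ Finset.range (N+1), ∑ Γs : Fin n → VF,
    (flatEnergy 1 t (applyComp Γs φ) + (t : ℝ) ^ (-δ) * flatEnergy 1 t (applyComp Γs ψ)))
  + (⨆ s : {s : ℝ // 2 ≤ s}, ∑ n ∈ Finset.range (N - 5 + 1), ∑ Γs : Fin n → VF,
    (Real.sqrt (hypEnergy m s (applyComp Γs φ))
      + (s : ℝ) ^ (-δ) * Real.sqrt (hypEnergy 1 s (applyComp Γs ψ))))

theorem pder_contDiff {φ : (Fin 4 → ℝ) → ℝ} (hφ : ContDiff ℝ (⊤ : ℕ∞) φ) (α : Fin 4) :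
    ContDiff ℝ (⊤ : ℕ∞) (pder α φ) :=
  (hφ.fderiv_right (m := (⊤ : ℕ∞)) (by simp)).clm_apply contDiff_const

theorem pder_comm {φ : (Fin 4 → ℝ) → ℝ} (hφ : ContDiff ℝ (⊤ : ℕ∞) φ) (α β : Fin 4)
    (y : Fin 4 → ℝ) : pder α (pder β φ) y = pder β (pder α φ) y := by
  have hd : DifferentiableAt ℝ (fderiv ℝ φ) y :=
    (hφ.fderiv_right (m := (⊤ : ℕ∞)) (by simp)).differentiable (by simp) y
  have key : ∀ γ δ : Fin 4, pder γ (pder δ φ) y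
      = fderiv ℝ (fderiv ℝ φ) y (Pi.single γ 1) (Pi.single δ 1) := by
    intro γ δ
    change fderiv ℝ (fun z => fderiv ℝ φ z (Pi.single δ 1)) y (Pi.single γ 1) = _
    rw [fderiv_clm_apply hd (differentiableAt_const _)]
    simp
  rw [key, key]
  exact (hφ.contDiffAt.isSymmSndFDerivAt
    (by simpa using WithTop.coe_le_coe.mpr (le_top : (2 : ℕ∞) ≤ ⊤))) _ _

/-- The closed cone `{r ≤ t - 1}`. -/
def lightCone : Set (Fin 4 → ℝ) := {y | rad (Fin.tail y) ≤ y 0 - 1}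

theorem lightCone_isClosed : IsClosed lightCone := by
  refine isClosed_le ?_ (by fun_prop)
  unfold rad Fin.tail
  fun_prop

theorem tsupport_subset_lightCone {u : (Fin 4 → ℝ) → ℝ}
    (hsupp : ∀ t : ℝ, ∀ x : Fin 3 → ℝ, t - 1 ≤ rad x → u (spt t x) = 0) :
    tsupport u ⊆ lightCone := by
  refine closure_minimal (fun y hy => ?_) lightCone_isClosed
  by_contra h
  refine hy ?_
  have := hsupp (y 0) (Fin.tail y) (not_le.mp h).le
  rwa [spt, Fin.cons_self_tail] at this

theorem tsupport_pder_subset {φ : (Fin 4 → ℝ) → ℝ} (hφ : tsupport φ ⊆ lightCone) (α : Fin 4) :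
    tsupport (pder α φ) ⊆ lightCone :=
  (tsupport_fderiv_apply_subset ℝ _).trans hφ

theorem hypPoint_notMem_lightCone {s S : ℝ} (hs : |s| ≤ S) {x : Fin 3 → ℝ}
    (hx : x ∉ Metric.closedBall (0 : Fin 3 → ℝ) (S ^ 2)) : hypPoint s x ∉ lightCone := by
  have hx' : S ^ 2 < ‖x‖ := by simpa using hx
  have hr : ‖x‖ ≤ rad x := by
    refine (pi_norm_le_iff_of_nonneg (Real.sqrt_nonneg _)).mpr fun i => ?_
    refine Real.abs_le_sqrt ?_
    exact Finset.single_le_sum (f := fun i => x i ^ 2) (fun i _ => sq_nonneg _) (Finset.mem_univ i)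
  have hs2 : s ^ 2 ≤ S ^ 2 := sq_le_sq' (by linarith [neg_abs_le s]) (by linarith [le_abs_self s])
  have hrr : rad x ^ 2 = ∑ i, x i ^ 2 := Real.sq_sqrt (Finset.sum_nonneg fun _ _ => sq_nonneg _)
  have h0 : 0 ≤ rad x := Real.sqrt_nonneg _
  intro hmem
  change rad x ≤ Real.sqrt (s ^ 2 + ∑ i, x i ^ 2) - 1 at hmem
  have h1 : Real.sqrt (s ^ 2 + ∑ i, x i ^ 2) < rad x + 1 := by
    rw [Real.sqrt_lt' (by linarith), ← hrr]
    nlinarith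
  linarith

theorem apply_hypPoint_eq_zero {φ : (Fin 4 → ℝ) → ℝ} (hφ : tsupport φ ⊆ lightCone)
    {s S : ℝ} (hs : |s| ≤ S) {x : Fin 3 → ℝ}
    (hx : x ∉ Metric.closedBall (0 : Fin 3 → ℝ) (S ^ 2)) : φ (hypPoint s x) = 0 :=
  image_eq_zero_of_notMem_tsupport fun h => hypPoint_notMem_lightCone hs hx (hφ h)

theorem continuous_hypPoint : Continuous fun p : ℝ × (Fin 3 → ℝ) => hypPoint p.1 p.2 := by
  unfold hypPoint spt
  refine continuous_pi fun i => ?_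
  refine Fin.cases ?_ (fun j => ?_) i
  · simp only [Fin.cons_zero]; fun_prop
  · simp only [Fin.cons_succ]; fun_prop

theorem hypPoint_zero_eq (s : ℝ) (x : Fin 3 → ℝ) :
    hypPoint s x 0 = Real.sqrt (s ^ 2 + ∑ i, x i ^ 2) := rfl

theorem hypPoint_zero_pos {s : ℝ} (hs : 0 < s) (x : Fin 3 → ℝ) : 0 < hypPoint s x 0 :=
  Real.sqrt_pos.mpr (by positivity)

theorem hypPoint_zero_sq (s : ℝ) (x : Fin 3 → ℝ) :
    hypPoint s x 0 ^ 2 = s ^ 2 + ∑ i, x i ^ 2 :=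
  Real.sq_sqrt (add_nonneg (sq_nonneg _) (Finset.sum_nonneg fun _ _ => sq_nonneg _))

theorem hasDerivAt_hypPoint_zero {s : ℝ} (hs : 0 < s) (x : Fin 3 → ℝ) :
    HasDerivAt (fun s => hypPoint s x 0) (s / hypPoint s x 0) s := by
  have hpos : s ^ 2 + ∑ i, x i ^ 2 ≠ 0 := by
    rw [← hypPoint_zero_sq]
    exact (pow_pos (hypPoint_zero_pos hs x) 2).ne'
  have h := ((hasDerivAt_pow 2 s).add_const (∑ i, x i ^ 2)).sqrt hpos
  refine HasDerivAt.congr_deriv h ?_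
  rw [hypPoint_zero_eq]
  norm_num
  field_simp

theorem hasDerivAt_hypPoint {s : ℝ} (hs : 0 < s) (x : Fin 3 → ℝ) :
    HasDerivAt (fun s => hypPoint s x) ((s / hypPoint s x 0) • Pi.single 0 1) s := by
  refine hasDerivAt_pi.mpr fun i => ?_
  refine Fin.cases ?_ (fun j => ?_) i
  · simpa using hasDerivAt_hypPoint_zero hs x
  · simpa [hypPoint, spt] using hasDerivAt_const s (x j)

theorem hasDerivAt_comp_hypPoint {φ : (Fin 4 → ℝ) → ℝ} (hφ : ContDiff ℝ (⊤ : ℕ∞) φ)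
    {s : ℝ} (hs : 0 < s) (x : Fin 3 → ℝ) :
    HasDerivAt (fun s => φ (hypPoint s x))
      (s / hypPoint s x 0 * pder 0 φ (hypPoint s x)) s := by
  have h := ((hφ.differentiable (by simp) (hypPoint s x)).hasFDerivAt).comp_hasDerivAt s
    (hasDerivAt_hypPoint hs x)
  simpa [pder] using! h

theorem hasLineDerivAt_hypPoint_zero {s : ℝ} (hs : 0 < s) (x : Fin 3 → ℝ) (a : Fin 3) :
    HasLineDerivAt ℝ (fun x => hypPoint s x 0) (x a / hypPoint s x 0) x (Pi.single a 1) := by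
  have hcoord : ∀ i, HasDerivAt (fun h : ℝ => (x + h • (Pi.single a (1 : ℝ) : Fin 3 → ℝ)) i)
      ((Pi.single a (1 : ℝ) : Fin 3 → ℝ) i) 0 := by
    intro i
    simpa using ((hasDerivAt_id (0 : ℝ)).mul_const _).const_add (x i)
  have hpos : s ^ 2 + ∑ i, (x + (0 : ℝ) • (Pi.single a (1 : ℝ) : Fin 3 → ℝ)) i ^ 2 ≠ 0 := by
    rw [← hypPoint_zero_sq]
    exact (pow_pos (hypPoint_zero_pos hs _) 2).ne'
  have h := ((HasDerivAt.fun_sum (u := Finset.univ) fun i _ => (hcoord i).fun_pow 2).const_add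
    (s ^ 2)).sqrt hpos
  refine HasDerivAt.congr_deriv h ?_
  rw [hypPoint_zero_eq]
  simp [Pi.single_apply]
  field_simp

theorem hasLineDerivAt_comp_hypPoint {φ : (Fin 4 → ℝ) → ℝ} (hφ : ContDiff ℝ (⊤ : ℕ∞) φ)
    {s : ℝ} (hs : 0 < s) (x : Fin 3 → ℝ) (a : Fin 3) :
    HasLineDerivAt ℝ (fun x => φ (hypPoint s x))
      (x a / hypPoint s x 0 * pder 0 φ (hypPoint s x) + pder a.succ φ (hypPoint s x)) x
      (Pi.single a 1) := by
  have hcurve : HasDerivAt (fun h : ℝ => hypPoint s (x + h • Pi.single a (1 : ℝ)))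
      ((x a / hypPoint s x 0) • Pi.single 0 1 + Pi.single a.succ 1) 0 := by
    refine hasDerivAt_pi.mpr fun i => ?_
    refine Fin.cases ?_ (fun j => ?_) i
    · simpa [Pi.single_apply] using! hasLineDerivAt_hypPoint_zero hs x a
    · simpa [hypPoint, spt, Pi.single_apply] using
        ((hasDerivAt_id (0 : ℝ)).mul_const ((Pi.single a (1 : ℝ) : Fin 3 → ℝ) j)).const_add (x j)
  have h := ((hφ.differentiable (by simp) (hypPoint s x)).hasFDerivAt).comp_hasDerivAt_of_eq
    (0 : ℝ) hcurve (by simp)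
  simpa [pder] using! h

theorem integral_eq_zero_of_hasLineDerivAt {g g' : (Fin 3 → ℝ) → ℝ} {v : Fin 3 → ℝ}
    (hg : Integrable g) (hg' : Integrable g') (h : ∀ x, HasLineDerivAt ℝ g (g' x) x v) :
    ∫ x, g' x = 0 := by
  have := integral_bilinear_hasLineDerivAt_right_eq_neg_left_of_integrable (μ := volume)
    (B := ContinuousLinearMap.mul ℝ ℝ) (f := fun _ => (1 : ℝ)) (f' := fun _ => 0)
    (g := g) (g' := g') (v := v) (by simp) (by simpa using hg') (by simpa using hg)
    (fun x _ => hasDerivAt_const _ _) (fun x _ => h x)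
  simpa using this

/-- The integrand of `hypEnergy`. -/
def energyDensity (m : ℝ) (u : (Fin 4 → ℝ) → ℝ) (s : ℝ) (x : Fin 3 → ℝ) : ℝ :=
  (pder 0 u (hypPoint s x)) ^ 2 + ∑ a : Fin 3, (pder a.succ u (hypPoint s x)) ^ 2
    + 2 * ∑ a : Fin 3, (x a / hypPoint s x 0) * pder 0 u (hypPoint s x)
      * pder a.succ u (hypPoint s x)
    + m ^ 2 * (u (hypPoint s x)) ^ 2

/-- The spatial energy flux through the hyperboloids, as a field on `ℝ³`. -/
def energyFlux (u : (Fin 4 → ℝ) → ℝ) (s : ℝ) (a : Fin 3) (x : Fin 3 → ℝ) : ℝ :=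
  -2 * (s / hypPoint s x 0 * (pder 0 u (hypPoint s x) * pder a.succ u (hypPoint s x)))

/-- The derivative of `energyFlux u s a` in the direction `x a`. -/
def energyFluxDeriv (u : (Fin 4 → ℝ) → ℝ) (s : ℝ) (a : Fin 3) (x : Fin 3 → ℝ) : ℝ :=
  -2 * (-(s * x a) / hypPoint s x 0 ^ 3
        * (pder 0 u (hypPoint s x) * pder a.succ u (hypPoint s x))
      + s / hypPoint s x 0
        * ((x a / hypPoint s x 0 * pder 0 (pder 0 u) (hypPoint s x)
              + pder a.succ (pder 0 u) (hypPoint s x)) * pder a.succ u (hypPoint s x)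
          + pder 0 u (hypPoint s x)
            * (x a / hypPoint s x 0 * pder 0 (pder a.succ u) (hypPoint s x)
              + pder a.succ (pder a.succ u) (hypPoint s x))))

/-- The source term produced by multiplying the equation with `2 (s / t) ∂_t u`. -/
def energySource (m : ℝ) (u : (Fin 4 → ℝ) → ℝ) (s : ℝ) (x : Fin 3 → ℝ) : ℝ :=
  2 * (s / hypPoint s x 0 * pder 0 u (hypPoint s x)
    * (- Box u (hypPoint s x) + m ^ 2 * u (hypPoint s x)))

theorem hasLineDerivAt_energyFlux {u : (Fin 4 → ℝ) → ℝ} (hu : ContDiff ℝ (⊤ : ℕ∞) u)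
    {s : ℝ} (hs : 0 < s) (a : Fin 3) (x : Fin 3 → ℝ) :
    HasLineDerivAt ℝ (energyFlux u s a) (energyFluxDeriv u s a x) x (Pi.single a 1) := by
  have ht := hypPoint_zero_pos hs x
  have h0 := hasLineDerivAt_hypPoint_zero hs x a
  have h1 := hasLineDerivAt_comp_hypPoint (pder_contDiff hu 0) hs x a
  have h2 := hasLineDerivAt_comp_hypPoint (pder_contDiff hu a.succ) hs x a
  unfold HasLineDerivAt at h0 h1 h2
  have h := (((hasDerivAt_const (0 : ℝ) s).fun_div h0 (by simpa using ht.ne')).fun_mul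
    (h1.fun_mul h2)).const_mul (-2)
  refine HasDerivAt.congr_deriv h ?_
  simp only [energyFluxDeriv, zero_smul, add_zero]
  field_simp
  ring

theorem hasDerivAt_energyDensity (m : ℝ) {u : (Fin 4 → ℝ) → ℝ} (hu : ContDiff ℝ (⊤ : ℕ∞) u)
    {s : ℝ} (hs : 0 < s) (x : Fin 3 → ℝ) :
    HasDerivAt (fun s => energyDensity m u s x)
      (energySource m u s x - ∑ a, energyFluxDeriv u s a x) s := by
  have ht := hypPoint_zero_pos hs x
  have h0 := hasDerivAt_hypPoint_zero hs x
  have hu0 := hasDerivAt_comp_hypPoint hu hs x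
  have hp := fun α => hasDerivAt_comp_hypPoint (pder_contDiff hu α) hs x
  have h := ((((hp 0).fun_pow 2).fun_add
    (HasDerivAt.fun_sum (u := Finset.univ) fun (a : Fin 3) _ => (hp a.succ).fun_pow 2)).fun_add
    ((HasDerivAt.fun_sum (u := Finset.univ) fun (a : Fin 3) _ =>
      ((((hasDerivAt_const s (x a)).fun_div h0 ht.ne').fun_mul (hp 0)).fun_mul
        (hp a.succ))).const_mul 2)).fun_add ((hu0.fun_pow 2).const_mul (m ^ 2))
  refine HasDerivAt.congr_deriv h ?_
  have hc := fun a : Fin 3 => pder_comm hu a.succ 0 (hypPoint s x)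
  simp only [energySource, energyFluxDeriv, Box, Fin.sum_univ_three, hc]
  field_simp
  ring

theorem energyDensity_eq (m : ℝ) (u : (Fin 4 → ℝ) → ℝ) {s : ℝ} (hs : 0 < s) (x : Fin 3 → ℝ) :
    energyDensity m u s x = (s / hypPoint s x 0 * pder 0 u (hypPoint s x)) ^ 2
      + ∑ a : Fin 3, (pder a.succ u (hypPoint s x)
          + x a / hypPoint s x 0 * pder 0 u (hypPoint s x)) ^ 2
      + m ^ 2 * (u (hypPoint s x)) ^ 2 := by
  have ht := hypPoint_zero_pos hs x
  have hsq := hypPoint_zero_sq s x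
  have h1 : (s / hypPoint s x 0) ^ 2 + ∑ a, (x a / hypPoint s x 0) ^ 2 = 1 := by
    simp only [div_pow, ← Finset.sum_div, ← add_div, ← hsq]
    exact div_self (by positivity)
  simp only [energyDensity, Fin.sum_univ_three] at h1 ⊢
  linear_combination -(pder 0 u (hypPoint s x)) ^ 2 * h1

/-- Differentiation under the integral sign for integrands with uniformly compact support. -/
theorem hasDerivAt_integral_of_eq_zero_off_compact {f f' : ℝ → (Fin 3 → ℝ) → ℝ} {a b s : ℝ}
    (hs : s ∈ Set.Ioo a b) {K : Set (Fin 3 → ℝ)} (hK : IsCompact K)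
    (hf : ∀ r ∈ Set.Icc a b, Continuous (f r))
    (hf0 : ∀ r ∈ Set.Icc a b, ∀ x ∉ K, f r x = 0) (hf0' : ∀ r ∈ Set.Icc a b, ∀ x ∉ K, f' r x = 0)
    (hf' : ContinuousOn f'.uncurry (Set.Icc a b ×ˢ Set.univ))
    (hderiv : ∀ r ∈ Set.Icc a b, ∀ x, HasDerivAt (fun r => f r x) (f' r x) r) :
    HasDerivAt (fun r => ∫ x, f r x) (∫ x, f' s x) s := by
  have hsI : s ∈ Set.Icc a b := Set.Ioo_subset_Icc_self hs
  have hnhds : Set.Icc a b ∈ nhds s := Icc_mem_nhds hs.1 hs.2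
  obtain ⟨C, hC⟩ := (isCompact_Icc.prod hK).exists_bound_of_continuousOn
    (hf'.mono (Set.prod_mono_right (Set.subset_univ K)))
  refine (hasDerivAt_integral_of_dominated_loc_of_deriv_le (F := f) (F' := f')
    (bound := K.indicator fun _ => C) hnhds ?_ ?_ ?_ ?_ ?_ ?_).2
  · filter_upwards [hnhds] with r hr using (hf r hr).aestronglyMeasurable
  · exact (hf s hsI).integrable_of_hasCompactSupport (HasCompactSupport.intro hK (hf0 s hsI))
  · have : Continuous (f' s) :=
      hf'.comp_continuous (by fun_prop : Continuous fun x : Fin 3 → ℝ => (s, x))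
        fun x => ⟨hsI, trivial⟩
    exact this.aestronglyMeasurable
  · refine Filter.Eventually.of_forall fun x r hr => ?_
    by_cases hx : x ∈ K
    · simpa [hx] using hC (r, x) ⟨hr, hx⟩
    · simp [hx, hf0' r hr x hx]
  · exact (integrable_indicator_iff hK.measurableSet).mpr
      (integrableOn_const hK.measure_lt_top.ne)
  · exact Filter.Eventually.of_forall fun x r hr => hderiv r hr x

theorem integral_mul_le_sqrt_mul_sqrt {f g : (Fin 3 → ℝ) → ℝ} (hf : Continuous f)
    (hg : Continuous g) (hfc : HasCompactSupport f) (hgc : HasCompactSupport g) :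
    ∫ x, f x * g x ≤ Real.sqrt (∫ x, f x ^ 2) * Real.sqrt (∫ x, g x ^ 2) := by
  have h := integral_mul_le_Lp_mul_Lq_of_nonneg (μ := volume) Real.HolderConjugate.two_two
    (Filter.Eventually.of_forall fun x => abs_nonneg (f x))
    (Filter.Eventually.of_forall fun x => abs_nonneg (g x))
    (hf.abs.memLp_of_hasCompactSupport hfc.norm) (hg.abs.memLp_of_hasCompactSupport hgc.norm)
  simp only [Real.rpow_two, sq_abs, ← Real.sqrt_eq_rpow] at h
  refine le_trans (integral_mono ?_ ?_ fun x => ?_) h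
  · exact (hf.mul hg).integrable_of_hasCompactSupport hfc.mul_right
  · exact (hf.abs.mul hg.abs).integrable_of_hasCompactSupport (HasCompactSupport.mul_right hfc.norm)
  · simpa only [← abs_mul] using le_abs_self _

/-- If `E' ≤ 2 √E F` then `√E` grows at most by the integral of `F`. -/
theorem sqrt_le_sqrt_add_integral {E E' F : ℝ → ℝ} {a b : ℝ} (hab : a ≤ b)
    (hE : ∀ r ∈ Set.Icc a b, HasDerivAt E (E' r) r) (hE0 : ∀ r ∈ Set.Icc a b, 0 ≤ E r)
    (hF : Continuous F) (hF0 : ∀ r, 0 ≤ F r)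
    (hE' : ∀ r ∈ Set.Icc a b, E' r ≤ 2 * Real.sqrt (E r) * F r) :
    Real.sqrt (E b) ≤ Real.sqrt (E a) + ∫ r in a..b, F r := by
  have key : ∀ ε : ℝ, 0 < ε →
      Real.sqrt (E b + ε) ≤ Real.sqrt (E a + ε) + ∫ r in a..b, F r := by
    intro ε hε
    have hpos : ∀ r ∈ Set.Icc a b, 0 < E r + ε := fun r hr => by linarith [hE0 r hr]
    have hd : ∀ r ∈ Set.Icc a b, HasDerivAt (fun r => Real.sqrt (E r + ε))
        (E' r / (2 * Real.sqrt (E r + ε))) r := fun r hr =>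
      ((hE r hr).add_const ε).sqrt (hpos r hr).ne'
    have h := intervalIntegral.sub_le_integral_of_hasDeriv_right_of_le hab
      (fun r hr => (hd r hr).continuousAt.continuousWithinAt)
      (fun r hr => (hd r (Set.Ioo_subset_Icc_self hr)).hasDerivWithinAt)
      (hF.continuousOn.integrableOn_compact isCompact_Icc) (fun r hr => ?_)
    · linarith
    · have hr' := Set.Ioo_subset_Icc_self hr
      have hsp := Real.sqrt_pos.mpr (hpos r hr')
      rw [div_le_iff₀ (by positivity)]
      have hle : Real.sqrt (E r) ≤ Real.sqrt (E r + ε) := Real.sqrt_le_sqrt (by linarith)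
      nlinarith [hE' r hr', hF0 r, mul_le_mul_of_nonneg_right hle (hF0 r)]
  have hl : ∀ c : ℝ, Filter.Tendsto (fun ε => Real.sqrt (c + ε)) (nhdsWithin 0 (Set.Ioi 0))
      (nhds (Real.sqrt c)) := by
    intro c
    have : Continuous fun ε => Real.sqrt (c + ε) := by fun_prop
    simpa using (this.tendsto 0).mono_left nhdsWithin_le_nhds
  exact le_of_tendsto_of_tendsto (hl _) ((hl _).add_const _)
    (by filter_upwards [self_mem_nhdsWithin] with ε hε using key ε hε)

theorem box_contDiff {u : (Fin 4 → ℝ) → ℝ} (hu : ContDiff ℝ (⊤ : ℕ∞) u) :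
    ContDiff ℝ (⊤ : ℕ∞) (Box u) :=
  (pder_contDiff (pder_contDiff hu 0) 0).neg.add
    (ContDiff.sum fun a _ => pder_contDiff (pder_contDiff hu a.succ) a.succ)

theorem continuous_comp_hypPoint {φ : (Fin 4 → ℝ) → ℝ} (hφ : ContDiff ℝ (⊤ : ℕ∞) φ) :
    Continuous fun p : ℝ × (Fin 3 → ℝ) => φ (hypPoint p.1 p.2) :=
  hφ.continuous.comp continuous_hypPoint

theorem continuousOn_div_hypPoint_zero {f : ℝ × (Fin 3 → ℝ) → ℝ} (hf : Continuous f) (n : ℕ) :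
    ContinuousOn (fun p : ℝ × (Fin 3 → ℝ) => f p / hypPoint p.1 p.2 0 ^ n)
      (Set.Ioi 0 ×ˢ Set.univ) :=
  hf.continuousOn.div
    (((continuous_apply 0).comp continuous_hypPoint).pow n).continuousOn
    fun p hp => (pow_pos (hypPoint_zero_pos hp.1 p.2) n).ne'

theorem continuousOn_energyDensity (m : ℝ) {u : (Fin 4 → ℝ) → ℝ}
    (hu : ContDiff ℝ (⊤ : ℕ∞) u) :
    ContinuousOn (fun p : ℝ × (Fin 3 → ℝ) => energyDensity m u p.1 p.2)
      (Set.Ioi 0 ×ˢ Set.univ) := by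
  have h0 := (continuous_comp_hypPoint hu).continuousOn (s := Set.Ioi 0 ×ˢ Set.univ)
  have h1 := fun α => (continuous_comp_hypPoint (pder_contDiff hu α)).continuousOn
    (s := Set.Ioi 0 ×ˢ Set.univ)
  have h2 := fun a : Fin 3 => continuousOn_div_hypPoint_zero
    (f := fun p => p.2 a) (by fun_prop) 1
  simp only [pow_one] at h2
  exact ((((h1 0).pow 2).add (continuousOn_finsetSum _ fun a _ => (h1 a.succ).pow 2)).add
    (continuousOn_const.mul (continuousOn_finsetSum _ fun a _ =>
      ((h2 a).mul (h1 0)).mul (h1 a.succ)))).add (continuousOn_const.mul (h0.pow 2))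

theorem continuousOn_energyFlux {u : (Fin 4 → ℝ) → ℝ}
    (hu : ContDiff ℝ (⊤ : ℕ∞) u) (a : Fin 3) :
    ContinuousOn (fun p : ℝ × (Fin 3 → ℝ) => energyFlux u p.1 a p.2)
      (Set.Ioi 0 ×ˢ Set.univ) := by
  have h1 := fun α => (continuous_comp_hypPoint (pder_contDiff hu α)).continuousOn
    (s := Set.Ioi 0 ×ˢ Set.univ)
  have h2 := continuousOn_div_hypPoint_zero (f := fun p => p.1) (by fun_prop) 1
  simp only [pow_one] at h2
  exact continuousOn_const.mul (h2.mul ((h1 0).mul (h1 a.succ)))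

theorem continuousOn_energyFluxDeriv {u : (Fin 4 → ℝ) → ℝ}
    (hu : ContDiff ℝ (⊤ : ℕ∞) u) (a : Fin 3) :
    ContinuousOn (fun p : ℝ × (Fin 3 → ℝ) => energyFluxDeriv u p.1 a p.2)
      (Set.Ioi 0 ×ˢ Set.univ) := by
  have h1 := fun α => (continuous_comp_hypPoint (pder_contDiff hu α)).continuousOn
    (s := Set.Ioi 0 ×ˢ Set.univ)
  have h2 := fun α β => (continuous_comp_hypPoint
    (pder_contDiff (pder_contDiff hu β) α)).continuousOn (s := Set.Ioi 0 ×ˢ Set.univ)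
  have h3 := continuousOn_div_hypPoint_zero (f := fun p => p.1) (by fun_prop) 1
  have h4 := continuousOn_div_hypPoint_zero (f := fun p => p.2 a) (by fun_prop) 1
  have h5 := continuousOn_div_hypPoint_zero (f := fun p => -(p.1 * p.2 a)) (by fun_prop) 3
  simp only [pow_one] at h3 h4
  exact continuousOn_const.mul ((h5.mul ((h1 0).mul (h1 a.succ))).add
    (h3.mul ((((h4.mul (h2 0 0)).add (h2 a.succ 0)).mul (h1 a.succ)).add
      ((h1 0).mul ((h4.mul (h2 0 a.succ)).add (h2 a.succ a.succ))))))

theorem continuousOn_energySource (m : ℝ) {u : (Fin 4 → ℝ) → ℝ}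
    (hu : ContDiff ℝ (⊤ : ℕ∞) u) :
    ContinuousOn (fun p : ℝ × (Fin 3 → ℝ) => energySource m u p.1 p.2)
      (Set.Ioi 0 ×ˢ Set.univ) := by
  have h0 := (continuous_comp_hypPoint hu).continuousOn (s := Set.Ioi 0 ×ˢ Set.univ)
  have h1 := (continuous_comp_hypPoint (pder_contDiff hu 0)).continuousOn
    (s := Set.Ioi 0 ×ˢ Set.univ)
  have h2 := (continuous_comp_hypPoint (box_contDiff hu)).continuousOn
    (s := Set.Ioi 0 ×ˢ Set.univ)
  have h3 := continuousOn_div_hypPoint_zero (f := fun p => p.1) (by fun_prop) 1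
  simp only [pow_one] at h3
  exact continuousOn_const.mul ((h3.mul h1).mul (h2.neg.add (continuousOn_const.mul h0)))

theorem continuous_slice {f : ℝ × (Fin 3 → ℝ) → ℝ}
    (hf : ContinuousOn f (Set.Ioi 0 ×ˢ Set.univ)) {s : ℝ} (hs : 0 < s) :
    Continuous fun x => f (s, x) :=
  hf.comp_continuous (by fun_prop : Continuous fun x : Fin 3 → ℝ => (s, x))
    fun _ => ⟨hs, trivial⟩

theorem tsupport_box_subset {u : (Fin 4 → ℝ) → ℝ} (hc : tsupport u ⊆ lightCone) :
    tsupport (Box u) ⊆ lightCone := by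
  refine closure_minimal (fun y hy => ?_) lightCone_isClosed
  by_contra h
  have h2 : ∀ α, pder α (pder α u) y = 0 := fun α => image_eq_zero_of_notMem_tsupport
    fun hm => h (tsupport_pder_subset (tsupport_pder_subset hc α) α hm)
  exact hy (by simp [Box, h2])

theorem energyDensity_eq_zero {u : (Fin 4 → ℝ) → ℝ} (hc : tsupport u ⊆ lightCone) {s S : ℝ}
    (hs : |s| ≤ S) {x : Fin 3 → ℝ} (hx : x ∉ Metric.closedBall (0 : Fin 3 → ℝ) (S ^ 2))
    (m : ℝ) :
    energyDensity m u s x = 0 := by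
  simp [energyDensity, apply_hypPoint_eq_zero hc hs hx,
    apply_hypPoint_eq_zero (tsupport_pder_subset hc _) hs hx]

theorem energyFlux_eq_zero {u : (Fin 4 → ℝ) → ℝ} (hc : tsupport u ⊆ lightCone) {s S : ℝ}
    (hs : |s| ≤ S) {x : Fin 3 → ℝ} (hx : x ∉ Metric.closedBall (0 : Fin 3 → ℝ) (S ^ 2))
    (a : Fin 3) :
    energyFlux u s a x = 0 := by
  simp [energyFlux, apply_hypPoint_eq_zero (tsupport_pder_subset hc _) hs hx]

theorem energyFluxDeriv_eq_zero {u : (Fin 4 → ℝ) → ℝ} (hc : tsupport u ⊆ lightCone) {s S : ℝ}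
    (hs : |s| ≤ S) {x : Fin 3 → ℝ} (hx : x ∉ Metric.closedBall (0 : Fin 3 → ℝ) (S ^ 2))
    (a : Fin 3) :
    energyFluxDeriv u s a x = 0 := by
  simp [energyFluxDeriv, apply_hypPoint_eq_zero (tsupport_pder_subset hc _) hs hx]

theorem energySource_eq_zero {u : (Fin 4 → ℝ) → ℝ} (hc : tsupport u ⊆ lightCone) {s S : ℝ}
    (hs : |s| ≤ S) {x : Fin 3 → ℝ} (hx : x ∉ Metric.closedBall (0 : Fin 3 → ℝ) (S ^ 2))
    (m : ℝ) :
    energySource m u s x = 0 := by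
  simp [energySource, apply_hypPoint_eq_zero (tsupport_pder_subset hc _) hs hx]

theorem integrable_of_eq_zero_off_ball {f : (Fin 3 → ℝ) → ℝ} (hf : Continuous f) {R : ℝ}
    (h0 : ∀ x ∉ Metric.closedBall (0 : Fin 3 → ℝ) R, f x = 0) : Integrable f :=
  hf.integrable_of_hasCompactSupport (HasCompactSupport.intro (isCompact_closedBall _ _) h0)

theorem hypEnergy_hasDerivAt (m : ℝ) {u : (Fin 4 → ℝ) → ℝ} (hu : ContDiff ℝ (⊤ : ℕ∞) u)
    (hc : tsupport u ⊆ lightCone) {s : ℝ} (hs : 0 < s) :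
    HasDerivAt (fun s => hypEnergy m s u) (∫ x, energySource m u s x) s := by
  have hpos : ∀ r ∈ Set.Icc (s / 2) (s + 1), 0 < r := fun r hr => by linarith [hr.1]
  have habs : ∀ r ∈ Set.Icc (s / 2) (s + 1), |r| ≤ s + 1 := fun r hr => by
    rw [abs_of_pos (hpos r hr)]; exact hr.2
  have hsS : |s| ≤ s := (abs_of_pos hs).le
  have hflux : ∀ a, Integrable (energyFluxDeriv u s a) := fun a =>
    integrable_of_eq_zero_off_ball (continuous_slice (continuousOn_energyFluxDeriv hu a) hs)
      fun x hx => energyFluxDeriv_eq_zero hc hsS hx a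
  have hsource : Integrable (energySource m u s) :=
    integrable_of_eq_zero_off_ball (continuous_slice (continuousOn_energySource m hu) hs)
      fun x hx => energySource_eq_zero hc hsS hx m
  have hzero : ∀ a, ∫ x, energyFluxDeriv u s a x = 0 := fun a =>
    integral_eq_zero_of_hasLineDerivAt
      (integrable_of_eq_zero_off_ball (continuous_slice (continuousOn_energyFlux hu a) hs)
        fun x hx => energyFlux_eq_zero hc hsS hx a)
      (hflux a) (hasLineDerivAt_energyFlux hu hs a)
  have h := hasDerivAt_integral_of_eq_zero_off_compact (s := s) (a := s / 2) (b := s + 1)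
    (f := fun s x => energyDensity m u s x)
    (f' := fun s x => energySource m u s x - ∑ a, energyFluxDeriv u s a x)
    ⟨by linarith, by linarith⟩
    (isCompact_closedBall (0 : Fin 3 → ℝ) ((s + 1) ^ 2))
    (fun r hr => continuous_slice (continuousOn_energyDensity m hu) (hpos r hr))
    (fun r hr x hx => energyDensity_eq_zero hc (habs r hr) hx m)
    (fun r hr x hx => by
      simp [energySource_eq_zero hc (habs r hr) hx m, energyFluxDeriv_eq_zero hc (habs r hr) hx])
    (((continuousOn_energySource m hu).sub
      (continuousOn_finsetSum _ fun a _ => continuousOn_energyFluxDeriv hu a)).mono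
      (Set.prod_mono_left hpos))
    (fun r hr x => hasDerivAt_energyDensity m hu (hpos r hr) x)
  rw [integral_sub hsource (integrable_finsetSum _ fun a _ => hflux a),
    integral_finsetSum _ fun a _ => hflux a] at h
  simpa [hzero] using! h

theorem hypEnergy_nonneg (m : ℝ) (u : (Fin 4 → ℝ) → ℝ) {s : ℝ} (hs : 0 < s) :
    0 ≤ hypEnergy m s u := by
  refine integral_nonneg fun x => ?_
  change 0 ≤ energyDensity m u s x
  rw [energyDensity_eq m u hs]
  positivity

theorem continuous_hypL2Sq {φ : (Fin 4 → ℝ) → ℝ} (hφ : ContDiff ℝ (⊤ : ℕ∞) φ)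
    (hc : tsupport φ ⊆ lightCone) : Continuous fun s => hypL2Sq s φ := by
  refine continuous_iff_continuousAt.mpr fun s => ?_
  have h := (continuous_parametric_integral_of_continuous (μ := volume)
    (f := fun s x => (φ (hypPoint s x)) ^ 2) ((continuous_comp_hypPoint hφ).fun_pow 2)
    (isCompact_closedBall (0 : Fin 3 → ℝ) ((|s| + 1) ^ 2))).continuousAt (x := s)
  refine h.congr ?_
  have hnhds : {r : ℝ | |r| < |s| + 1} ∈ nhds s :=
    (isOpen_lt continuous_abs continuous_const).mem_nhds (lt_add_one |s|)
  filter_upwards [hnhds] with r hr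
  refine setIntegral_eq_integral_of_forall_compl_eq_zero fun x hx => ?_
  simp [apply_hypPoint_eq_zero hc hr.le hx]

theorem integral_energySource_le (m : ℝ) {u : (Fin 4 → ℝ) → ℝ} (hu : ContDiff ℝ (⊤ : ℕ∞) u)
    (hc : tsupport u ⊆ lightCone) {s : ℝ} (hs : 0 < s) :
    ∫ x, energySource m u s x ≤ 2 * Real.sqrt (hypEnergy m s u)
      * Real.sqrt (hypL2Sq s fun y => - Box u y + m ^ 2 * u y) := by
  have hsS : |s| ≤ s := (abs_of_pos hs).le
  have hf : Continuous fun x => s / hypPoint s x 0 * pder 0 u (hypPoint s x) := by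
    have h1 := continuous_comp_hypPoint (pder_contDiff hu 0)
    have h3 := continuousOn_div_hypPoint_zero (f := fun p => p.1) (by fun_prop) 1
    simp only [pow_one] at h3
    exact continuous_slice (h3.mul h1.continuousOn) hs
  have hf0 : ∀ x ∉ Metric.closedBall (0 : Fin 3 → ℝ) (s ^ 2),
      s / hypPoint s x 0 * pder 0 u (hypPoint s x) = 0 := fun x hx => by
    simp [apply_hypPoint_eq_zero (tsupport_pder_subset hc 0) hsS hx]
  have hg : Continuous fun x => - Box u (hypPoint s x) + m ^ 2 * u (hypPoint s x) :=
    continuous_slice ((continuous_comp_hypPoint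
      ((box_contDiff hu).neg.add (contDiff_const.mul hu) :
        ContDiff ℝ (⊤ : ℕ∞) fun y => - Box u y + m ^ 2 * u y)).continuousOn) hs
  have hCS := integral_mul_le_sqrt_mul_sqrt hf hg
    (HasCompactSupport.intro (isCompact_closedBall _ _) hf0)
    (HasCompactSupport.intro (isCompact_closedBall (0 : Fin 3 → ℝ) (s ^ 2)) fun x hx => by
      simp [apply_hypPoint_eq_zero (tsupport_box_subset hc) hsS hx,
        apply_hypPoint_eq_zero hc hsS hx])
  have hE : ∫ x, (s / hypPoint s x 0 * pder 0 u (hypPoint s x)) ^ 2 ≤ hypEnergy m s u := by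
    refine integral_mono (integrable_of_eq_zero_off_ball (hf.pow 2) (R := s ^ 2) fun x hx => by
        simp [hf0 x hx])
      (integrable_of_eq_zero_off_ball (continuous_slice (continuousOn_energyDensity m hu) hs)
        fun x hx => energyDensity_eq_zero hc hsS hx m) fun x => ?_
    change _ ≤ energyDensity m u s x
    rw [energyDensity_eq m u hs, add_assoc]
    exact le_add_of_nonneg_right (by positivity)
  simp only [energySource, integral_const_mul]
  rw [mul_assoc]
  refine mul_le_mul_of_nonneg_left (hCS.trans ?_) zero_le_two
  exact mul_le_mul_of_nonneg_right (Real.sqrt_le_sqrt hE) (Real.sqrt_nonneg _)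

/-- Hyperboloidal energy estimate:
`E_m(s,u)^{1/2} ≤ E_m(2,u)^{1/2} + ∫₂^s ‖-□u + m²u‖_{L²_f(H_{s'})} ds'`. -/
theorem hyperboloidal_energy_estimate
    (m : ℝ) (hm : 0 ≤ m) (s : ℝ) (hs : 2 ≤ s)
    (u : (Fin 4 → ℝ) → ℝ) (hu : ContDiff ℝ (⊤ : ℕ∞) u)
    (hsupp : ∀ t : ℝ, ∀ x : Fin 3 → ℝ, t - 1 ≤ rad x → u (spt t x) = 0) :
    Real.sqrt (hypEnergy m s u)
      ≤ Real.sqrt (hypEnergy m 2 u)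
        + ∫ s' in (2:ℝ)..s,
            Real.sqrt (hypL2Sq s' (fun y => - Box u y + m^2 * u y)) := by
  have hc := tsupport_subset_lightCone hsupp
  have hpos : ∀ r ∈ Set.Icc 2 s, 0 < r := fun r hr => by linarith [hr.1]
  have hL2 : Continuous fun r => hypL2Sq r fun y => - Box u y + m ^ 2 * u y := by
    refine continuous_hypL2Sq ((box_contDiff hu).neg.add (contDiff_const.mul hu)) ?_
    refine (tsupport_add _ _).trans (Set.union_subset ?_ ?_)
    · exact (closure_mono (Function.support_neg _).subset).trans (tsupport_box_subset hc)
    · exact tsupport_mul_subset_right.trans hc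
  exact sqrt_le_sqrt_add_integral hs (fun r hr => hypEnergy_hasDerivAt m hu hc (hpos r hr))
    (fun r hr => hypEnergy_nonneg m u (hpos r hr)) hL2.sqrt (fun r => Real.sqrt_nonneg _)
    (fun r hr => integral_energySource_le m hu hc (hpos r hr))
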